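/- Let X be a dendroid in the plane and W ⊂ ℝ² a simply connected domain (bounded, open, connected, simply connected). If X \ W is connected, then W \ X is connected. -/

import Mathlib

open Set Filter Topology

/-- The Euclidean plane. -/
abbrev Plane := EuclideanSpace ℝ (Fin 2)

section Defs

variable {α : Type*} [TopologicalSpace α]

/-- `A` is an arc with endpoints `a` and `b`: a homeomorphic image of `[0,1]`
sending `0 ↦ a` and `1 ↦ b`. -/
def IsArcWithEndpoints (A : Set α) (a b : α) : Prop :=
  ∃ f : ℝ → α, ContinuousOn f (Set.Icc 0 1) ∧ Set.InjOn f (Set.Icc 0 1) ∧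
    f '' (Set.Icc 0 1) = A ∧ f 0 = a ∧ f 1 = b

/-- `A` is an arc. -/
def IsArc (A : Set α) : Prop := ∃ a b, IsArcWithEndpoints A a b

/-- Every two distinct points of `X` are joined by an arc inside `X`. -/
def ArcwiseConnected (X : Set α) : Prop :=
  ∀ x ∈ X, ∀ y ∈ X, x ≠ y → ∃ A, A ⊆ X ∧ IsArcWithEndpoints A x y

/-- Every two subcontinua of `X` have connected intersection. -/
def HereditarilyUnicoherent (X : Set α) : Prop :=
  ∀ K L : Set α, K ⊆ X → L ⊆ X → IsCompact K → IsConnected K →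
    IsCompact L → IsConnected L → IsPreconnected (K ∩ L)

/-- A dendroid: a hereditarily unicoherent, arcwise connected continuum. -/
def IsDendroid (X : Set α) : Prop :=
  IsCompact X ∧ IsConnected X ∧ HereditarilyUnicoherent X ∧ ArcwiseConnected X

/-- The set of endpoints of `X`: points that are endpoints of every arc in `X`
containing them. -/
def Endpoints (X : Set α) : Set α :=
  {e | e ∈ X ∧ ∀ A : Set α, A ⊆ X → IsArc A → e ∈ A → ∃ b, IsArcWithEndpoints A e b}

/-- `X` is Suslinian: every collection of pairwise-disjoint non-degenerate
subcontinua of `X` is countable. -/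
def IsSuslinian (X : Set α) : Prop :=
  ∀ S : Set (Set α), (∀ K ∈ S, K ⊆ X ∧ IsCompact K ∧ IsConnected K ∧ K.Nontrivial) →
    S.PairwiseDisjoint id → S.Countable

/-- The arc component of `x` inside the set `S`. -/
def arcComponentIn (S : Set α) (x : α) : Set α :=
  {y | y ∈ S ∧ (y = x ∨ ∃ A, A ⊆ S ∧ IsArcWithEndpoints A x y)}

/-- The collection of arc components of `X \ {x}`; its cardinality is the order of `x`. -/
def orderComponents (X : Set α) (x : α) : Set (Set α) :=
  {C | ∃ y ∈ X \ {x}, C = arcComponentIn (X \ {x}) y}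

/-- Ramification points of `X`: points of order at least 3. -/
def RamificationPoints (X : Set α) : Set α :=
  {x | x ∈ X ∧ 3 ≤ (orderComponents X x).encard}

/-- `A` is a clopen subset of the subspace `Y`. -/
def IsClopenIn (Y A : Set α) : Prop :=
  A ⊆ Y ∧ (∃ U, IsOpen U ∧ A = Y ∩ U) ∧ (∃ C, IsClosed C ∧ A = Y ∩ C)

/-- The quasicomponent of `x` in the subspace `Y`: the intersection of all
clopen subsets of `Y` containing `x`. -/
def quasicomponentIn (Y : Set α) (x : α) : Set α :=
  {y ∈ Y | ∀ A : Set α, IsClopenIn Y A → x ∈ A → y ∈ A}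

/-- `Y` is hereditarily disconnected: it contains no non-degenerate connected subset. -/
def HereditarilyDisconnected (Y : Set α) : Prop :=
  ∀ S : Set α, S ⊆ Y → IsPreconnected S → S.Subsingleton

end Defs

/-- The point `x` of `X` is (arcwise) accessible from `ℝ² \ X`. -/
def AccessiblePoint (X : Set Plane) (x : Plane) : Prop :=
  ∃ A : Set Plane, IsArc A ∧ A ∩ X = {x}

/-- `σ` separates the points `b` and `d` in the plane: no connected subset of the
complement of `σ` contains both. -/
def SeparatesPoints (σ : Set Plane) (b d : Plane) : Prop :=
  b ∉ σ ∧ d ∉ σ ∧ ∀ K : Set Plane, K ⊆ σᶜ → IsPreconnected K → b ∈ K → d ∉ K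

/-- A simple closed curve in the plane: the image of a period-1 parametrization
injective on `[0,1)`. -/
def IsSimpleClosedCurve (O : Set Plane) : Prop :=
  ∃ f : ℝ → Plane, Continuous f ∧ Function.Periodic f 1 ∧
    Set.InjOn f (Set.Ico 0 1) ∧ f '' (Set.Ico 0 1) = O

/-- The dendroid `X` is smooth at `p`: there is a choice `arcTo x` of the unique arc
from `x` to `p` (reduced to `{p}` for `x = p`) such that `xₙ → x` in `X` implies
`arcTo xₙ → arcTo x` in the Hausdorff distance. -/
def DendroidSmoothAt (X : Set Plane) (p : Plane) : Prop :=
  p ∈ X ∧ ∃ arcTo : Plane → Set Plane,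
    arcTo p = {p} ∧
    (∀ x ∈ X, x ≠ p → arcTo x ⊆ X ∧ IsArcWithEndpoints (arcTo x) x p) ∧
    (∀ (xs : ℕ → Plane) (x : Plane), (∀ n, xs n ∈ X) → x ∈ X →
      Filter.Tendsto xs Filter.atTop (nhds x) →
      Filter.Tendsto (fun n => EMetric.hausdorffEdist (arcTo (xs n)) (arcTo x))
        Filter.atTop (nhds 0))

/-- A space is zero-dimensional if it has a basis of clopen sets. -/
def IsZeroDimensionalSpace (β : Type*) [TopologicalSpace β] : Prop :=
  ∀ (x : β) (U : Set β), IsOpen U → x ∈ U → ∃ V : Set β, IsClopen V ∧ x ∈ V ∧ V ⊆ U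

/-- A space is almost zero-dimensional if it has a neighborhood basis of sets
which are intersections of clopen sets. -/
def IsAlmostZeroDimensionalSpace (β : Type*) [TopologicalSpace β] : Prop :=
  ∀ (x : β) (U : Set β), IsOpen U → x ∈ U →
    ∃ V : Set β, V ∈ nhds x ∧ V ⊆ U ∧
      ∃ 𝒞 : Set (Set β), (∀ C ∈ 𝒞, IsClopen C) ∧ V = ⋂₀ 𝒞

/-- The union of `W` with all of the bounded connected components of its complement. -/
def boundedComplementaryFill (W : Set Plane) : Set Plane :=
  W ∪ ⋃₀ {K | (∃ x ∈ Wᶜ, K = connectedComponentIn Wᶜ x) ∧ Bornology.IsBounded K}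

/-- A Bellamy dendroid: a (non-degenerate) smooth plane dendroid whose endpoint
set is connected. -/
def IsBellamyDendroid (K : Set Plane) : Prop :=
  IsDendroid K ∧ K.Nontrivial ∧ (∃ q, DendroidSmoothAt K q) ∧ IsConnected (Endpoints K)

/-- The middle-thirds Cantor set. -/
noncomputable def cantorC : Set ℝ :=
  {x | ∃ a : ℕ → Bool, x = ∑' i, (if a i then (2 : ℝ) else 0) / 3 ^ (i + 1)}

/-- `f` has a continuous logarithm on `S`. -/
def HasLogOn {α : Type*} [TopologicalSpace α] (f : α → ℂ) (S : Set α) : Prop :=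
  ∃ h : α → ℂ, ContinuousOn h S ∧ ∀ z ∈ S, Complex.exp (h z) = f z

section Logarithms

variable {α : Type*} [TopologicalSpace α] {f g : α → ℂ} {A B S : Set α}

/-- Two continuous logarithms of the same function on a preconnected set differ by a constant. -/
theorem IsPreconnected.sub_eq_sub_of_exp_eq {h k : α → ℂ} (hS : IsPreconnected S)
    (hh : ContinuousOn h S) (hk : ContinuousOn k S)
    (hexp : ∀ z ∈ S, Complex.exp (h z) = Complex.exp (k z)) {x y : α} (hx : x ∈ S) (hy : y ∈ S) :
    h x - k x = h y - k y := by
  have hpi : (2 * Real.pi * Complex.I : ℂ) ≠ 0 := Complex.two_pi_I_ne_zero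
  have hint : ∀ z ∈ S, ∃ n : ℤ, h z - k z = n * (2 * Real.pi * Complex.I) := by
    intro z hz
    obtain ⟨n, hn⟩ := Complex.exp_eq_exp_iff_exists_int.1 (hexp z hz)
    exact ⟨n, by rw [hn]; ring⟩
  let d : α → ℝ := fun z => ((h z - k z) / (2 * Real.pi * Complex.I)).re
  have hd : ContinuousOn d S :=
    Complex.continuous_re.comp_continuousOn ((hh.sub hk).div_const _)
  have hdval : ∀ z ∈ S, ∃ n : ℤ, d z = n ∧ h z - k z = n * (2 * Real.pi * Complex.I) := by
    intro z hz
    obtain ⟨n, hn⟩ := hint z hz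
    refine ⟨n, ?_, hn⟩
    simp only [d, hn]
    rw [mul_div_cancel_right₀ _ hpi]
    simp
  have hdisc : IsDiscrete (Set.range ((↑) : ℤ → ℝ)) :=
    Int.isClosedEmbedding_coe_real.isEmbedding.isDiscrete_range
  have hdxy : d x = d y := hS.constant_of_mapsTo hdisc hd
    (fun z hz => by obtain ⟨n, hn, -⟩ := hdval z hz; exact ⟨n, hn.symm⟩) hx hy
  obtain ⟨n, hn, hn'⟩ := hdval x hx
  obtain ⟨m, hm, hm'⟩ := hdval y hy
  have hnm : n = m := by
    have : (n : ℝ) = m := by rw [← hn, ← hm, hdxy]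
    exact_mod_cast this
  rw [hn', hm', hnm]

theorem HasLogOn.mono (hf : HasLogOn f B) (hAB : A ⊆ B) : HasLogOn f A := by
  obtain ⟨h, hc, he⟩ := hf
  exact ⟨h, hc.mono hAB, fun z hz => he z (hAB hz)⟩

theorem HasLogOn.congr (hf : HasLogOn f S) (hfg : EqOn f g S) : HasLogOn g S := by
  obtain ⟨h, hc, he⟩ := hf
  exact ⟨h, hc, fun z hz => (he z hz).trans (hfg hz)⟩

theorem HasLogOn.mul (hf : HasLogOn f S) (hg : HasLogOn g S) : HasLogOn (fun z => f z * g z) S := by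
  obtain ⟨h, hc, he⟩ := hf
  obtain ⟨k, kc, ke⟩ := hg
  exact ⟨fun z => h z + k z, hc.add kc, fun z hz => by rw [Complex.exp_add, he z hz, ke z hz]⟩

theorem HasLogOn.inv (hf : HasLogOn f S) : HasLogOn (fun z => (f z)⁻¹) S := by
  obtain ⟨h, hc, he⟩ := hf
  exact ⟨fun z => -h z, hc.neg, fun z hz => by rw [Complex.exp_neg, he z hz]⟩

theorem hasLogOn_of_mem_slitPlane (hf : ContinuousOn f S) (hS : ∀ z ∈ S, f z ∈ Complex.slitPlane) :
    HasLogOn f S :=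
  ⟨fun z => Complex.log (f z), hf.clog hS,
    fun z hz => Complex.exp_log (Complex.slitPlane_ne_zero (hS z hz))⟩

/-- Logarithms on two closed sets with preconnected intersection can be glued. -/
theorem HasLogOn.union (hfA : HasLogOn f A) (hfB : HasLogOn f B) (hA : IsClosed A)
    (hB : IsClosed B) (hAB : IsPreconnected (A ∩ B)) : HasLogOn f (A ∪ B) := by
  classical
  obtain ⟨h, hc, he⟩ := hfA
  obtain ⟨k, kc, ke⟩ := hfB
  obtain ⟨c, hc1, hcAB⟩ : ∃ c : ℂ, Complex.exp c = 1 ∧ ∀ z ∈ A ∩ B, h z = k z + c := by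
    rcases (A ∩ B).eq_empty_or_nonempty with h0 | ⟨x, hx⟩
    · exact ⟨0, Complex.exp_zero, by simp [h0]⟩
    · refine ⟨h x - k x, ?_, fun z hz => ?_⟩
      · rw [Complex.exp_sub, he x hx.1, ← ke x hx.2, div_self (Complex.exp_ne_zero _)]
      · rw [hAB.sub_eq_sub_of_exp_eq (hc.mono inter_subset_left) (kc.mono inter_subset_right)
          (fun w hw => by rw [he w hw.1, ke w hw.2]) hx hz]
        ring
  have hpA : EqOn (A.piecewise h fun z => k z + c) h A := fun z hz => by simp [hz]
  have hpB : EqOn (A.piecewise h fun z => k z + c) (fun z => k z + c) B := fun z hz => by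
    by_cases hzA : z ∈ A
    · simp [hzA, hcAB z ⟨hzA, hz⟩]
    · simp [hzA]
  refine ⟨A.piecewise h fun z => k z + c, ?_, ?_⟩
  · exact (hc.congr hpA).union_of_isClosed ((kc.add continuousOn_const).congr hpB) hA hB
  · rintro z (hz | hz)
    · rw [hpA hz, he z hz]
    · rw [hpB hz, Complex.exp_add, hc1, mul_one, ke z hz]

/-- A logarithm on a closed subset of a normal space extends to a continuous function. -/
theorem HasLogOn.exists_continuous [NormalSpace α] (hf : HasLogOn f S) (hS : IsClosed S) :
    ∃ H : C(α, ℂ), ∀ z ∈ S, Complex.exp (H z) = f z := by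
  obtain ⟨h, hc, he⟩ := hf
  obtain ⟨H, hH⟩ := ContinuousMap.exists_restrict_eq hS ⟨S.domRestrict h, hc.domRestrict⟩
  refine ⟨H, fun z hz => ?_⟩
  have : H z = h z := congrArg (fun φ : C(S, ℂ) => φ ⟨z, hz⟩) hH
  rw [this, he z hz]

end Logarithms

section Continua

variable {α : Type*} [MetricSpace α] {K A : Set α}

/-- The intersection of a chain of continua is connected. -/
theorem IsChain.isConnected_sInter {c : Set (Set α)} (hchain : IsChain (· ⊆ ·) c)
    (hne : c.Nonempty) (hc : ∀ K ∈ c, IsCompact K ∧ IsConnected K) : IsConnected (⋂₀ c) := by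
  have : Nonempty c := hne.to_subtype
  have hdir : Directed (· ⊇ ·) (fun K : c => (K : Set α)) :=
    fun K L => (hchain.total K.2 L.2).elim (fun h => ⟨K, Subset.rfl, h⟩)
      fun h => ⟨L, h, Subset.rfl⟩
  have hcomp : ∀ K : c, IsCompact (K : Set α) := fun K => (hc K K.2).1
  refine ⟨?_, ?_⟩
  · rw [sInter_eq_iInter]
    exact IsCompact.nonempty_iInter_of_directed_nonempty_isCompact_isClosed _ hdir
      (fun K => (hc K K.2).2.nonempty) hcomp fun K => (hcomp K).isClosed
  · rw [isPreconnected_iff_subset_of_fully_disjoint_closed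
      (isClosed_sInter fun K hK => (hc K hK).1.isClosed)]
    intro u v hu hv huv hdisj
    obtain ⟨U, V, hU, hV, huU, hvV, hUV⟩ := normal_separation hu hv hdisj
    obtain ⟨K, hK⟩ := exists_subset_nhds_of_isCompact hdir hcomp (U := U ∪ V) (fun x hx => by
      rw [← sInter_eq_iInter] at hx
      exact (hU.union hV).mem_nhds (union_subset_union huU hvV (huv hx)))
    have hsub : ⋂₀ c ⊆ K := sInter_subset_of_mem K.2
    rcases isPreconnected_iff_subset_of_disjoint.1 (hc K K.2).2.isPreconnected U V hU hV hK
      (by rw [hUV.inter_eq, inter_empty]) with h | h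
    · left
      intro x hx
      exact (huv hx).resolve_right fun hxv => hUV.le_bot ⟨h (hsub hx), hvV hxv⟩
    · right
      intro x hx
      exact (huv hx).resolve_left fun hxu => hUV.le_bot ⟨huU hxu, h (hsub hx)⟩

/-- If `K \ A` splits along the open sets `u` and `v`, then `A` together with the part of
`K \ A` outside `v` is still connected. -/
theorem IsPreconnected.union_diff_of_separation {u v : Set α} (hK : IsPreconnected K)
    (hKcl : IsClosed K) (hA : IsPreconnected A) (hAcl : IsClosed A) (hAK : A ⊆ K)
    (hu : IsOpen u) (hv : IsOpen v) (huv : K \ A ⊆ u ∪ v) (hdisj : K \ A ∩ (u ∩ v) = ∅) :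
    IsPreconnected (A ∪ (K \ v)) := by
  have hP : IsClosed (A ∪ (K \ v)) := hAcl.union (hKcl.sdiff hv)
  have hQ : IsClosed (A ∪ (K \ u)) := hAcl.union (hKcl.sdiff hu)
  have key : ∀ s t : Set α, IsClosed s → IsClosed t → A ∪ (K \ v) ⊆ s ∪ t → Disjoint s t →
      A ⊆ s → A ∪ (K \ v) ⊆ s ∨ A ∪ (K \ v) ⊆ t := by
    intro s t hs ht hst hdst hAs
    have hcov : K ⊆ (s ∪ (A ∪ (K \ u))) ∪ (t ∩ (A ∪ (K \ v))) := by
      intro x hx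
      by_cases hxA : x ∈ A
      · exact Or.inl (Or.inr (Or.inl hxA))
      by_cases hxu : x ∈ u
      · have hxv : x ∉ v := fun hxv => by
          have : x ∈ K \ A ∩ (u ∩ v) := ⟨⟨hx, hxA⟩, hxu, hxv⟩
          rw [hdisj] at this
          exact this
        have hxP : x ∈ A ∪ (K \ v) := Or.inr ⟨hx, hxv⟩
        rcases hst hxP with h | h
        · exact Or.inl (Or.inl h)
        · exact Or.inr ⟨h, hxP⟩
      · exact Or.inl (Or.inr (Or.inr ⟨hx, hxu⟩))
    have hdisj' : ∀ x, x ∈ s ∪ (A ∪ (K \ u)) → x ∈ t ∩ (A ∪ (K \ v)) → False := by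
      rintro x hx ⟨hxt, hxP⟩
      have hxs : x ∉ s := fun hxs => hdst.le_bot ⟨hxs, hxt⟩
      have hxA : x ∉ A := fun h => hxs (hAs h)
      have hxu : x ∈ K \ u := (hx.resolve_left hxs).resolve_left hxA
      have hxv : x ∈ K \ v := hxP.resolve_left hxA
      exact (huv ⟨hxu.1, hxA⟩).elim hxu.2 hxv.2
    have hPK : A ∪ (K \ v) ⊆ K := union_subset hAK sdiff_subset
    rcases isPreconnected_iff_subset_of_disjoint_closed.1 hK _ _ (hs.union hQ) (ht.inter hP) hcov
      (eq_empty_of_forall_notMem fun x hx => hdisj' x hx.2.1 hx.2.2) with h | h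
    · exact Or.inl fun x hx => (hst hx).resolve_right fun hxt => hdisj' x (h (hPK hx)) ⟨hxt, hx⟩
    · exact Or.inr fun x hx => (h (hPK hx)).1
  rw [isPreconnected_iff_subset_of_fully_disjoint_closed hP]
  intro s t hs ht hst hdst
  rcases isPreconnected_iff_subset_of_disjoint_closed.1 hA s t hs ht
    (subset_union_left.trans hst) (by rw [hdst.inter_eq, inter_empty]) with h | h
  · exact key s t hs ht hst hdst h
  · exact (key t s ht hs (by rwa [union_comm t s]) hdst.symm h).symm

/-- Connected components of a closed set are closed. -/
theorem IsClosed.isClosed_connectedComponentIn (hK : IsClosed K) {x : α} :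
    IsClosed (connectedComponentIn K x) := by
  by_cases hx : x ∈ K
  · refine isClosed_of_closure_subset ?_
    exact isPreconnected_connectedComponentIn.closure.subset_connectedComponentIn
      (subset_closure (mem_connectedComponentIn hx))
      (closure_minimal (connectedComponentIn_subset K x) hK)
  · rw [connectedComponentIn_eq_empty hx]
    exact isClosed_empty

/-- A continuum is decomposable if it is the union of two proper subcontinua. -/
def IsDecomposable (K : Set α) : Prop :=
  ∃ A B : Set α, IsCompact A ∧ IsConnected A ∧ IsCompact B ∧ IsConnected B ∧
    A ≠ K ∧ B ≠ K ∧ A ∪ B = K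

/-- Proper subcontinua of an indecomposable continuum have empty interior. -/
theorem inter_eq_empty_of_not_isDecomposable {U : Set α} (hK : IsCompact K)
    (hKc : IsConnected K) (hdec : ¬ IsDecomposable K) (hA : IsCompact A) (hAc : IsConnected A)
    (hAK : A ⊆ K) (hne : A ≠ K) (hU : IsOpen U) (hUA : U ∩ K ⊆ A) : U ∩ K = ∅ := by
  have hdiff : (K \ A).Nonempty := nonempty_of_not_subset fun h => hne (hAK.antisymm h)
  by_cases hpre : IsPreconnected (K \ A)
  · have hclK : closure (K \ A) ⊆ K := closure_minimal sdiff_subset hK.isClosed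
    have hB : closure (K \ A) = K := by
      by_contra hB
      refine hdec ⟨A, closure (K \ A), hA, hAc, hK.of_isClosed_subset isClosed_closure hclK,
        ⟨hdiff.closure, hpre.closure⟩, hne, hB, (union_subset hAK hclK).antisymm fun x hx => ?_⟩
      by_cases hxA : x ∈ A
      · exact Or.inl hxA
      · exact Or.inr (subset_closure ⟨hx, hxA⟩)
    refine eq_empty_of_forall_notMem fun x hx => ?_
    have hxcl : x ∈ closure (K \ A) := hB.ge hx.2
    obtain ⟨y, hyU, hyK, hyA⟩ := mem_closure_iff.1 hxcl U hU hx.1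
    exact hyA (hUA ⟨hyU, hyK⟩)
  · exfalso
    simp only [IsPreconnected, not_forall] at hpre
    obtain ⟨u, v, hu, hv, huv, ⟨x, hx, hxu⟩, ⟨y, hy, hyv⟩, hdisj⟩ := hpre
    rw [not_nonempty_iff_eq_empty] at hdisj
    have hdisj' : K \ A ∩ (v ∩ u) = ∅ := by rwa [inter_comm v u]
    have hnot : ∀ z ∈ K \ A, z ∈ u → z ∉ v := fun z hz hzu hzv => by
      have : z ∈ K \ A ∩ (u ∩ v) := ⟨hz, hzu, hzv⟩
      rw [hdisj] at this
      exact this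
    refine hdec ⟨A ∪ (K \ v), A ∪ (K \ u), hA.union (hK.diff hv),
      ⟨hAc.nonempty.mono subset_union_left, hKc.isPreconnected.union_diff_of_separation hK.isClosed
        hAc.isPreconnected hA.isClosed hAK hu hv huv hdisj⟩, hA.union (hK.diff hu),
      ⟨hAc.nonempty.mono subset_union_left, hKc.isPreconnected.union_diff_of_separation hK.isClosed
        hAc.isPreconnected hA.isClosed hAK hv hu (by rwa [union_comm v u]) hdisj'⟩, ?_, ?_, ?_⟩
    · intro h
      have : y ∈ A ∪ (K \ v) := h.ge hy.1
      exact (this.resolve_left hy.2).2 hyv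
    · intro h
      have : x ∈ A ∪ (K \ u) := h.ge hx.1
      exact (this.resolve_left hx.2).2 hxu
    · refine Subset.antisymm (union_subset (union_subset hAK sdiff_subset)
        (union_subset hAK sdiff_subset)) fun z hz => ?_
      by_cases hzA : z ∈ A
      · exact Or.inl (Or.inl hzA)
      by_cases hzu : z ∈ u
      · exact Or.inl (Or.inr ⟨hz, hnot z ⟨hz, hzA⟩ hzu⟩)
      · exact Or.inr (Or.inr ⟨hz, hzu⟩)

/-- If every point of a continuum lies in a proper subcontinuum containing a fixed point `p`,
then the continuum is decomposable. -/
theorem isDecomposable_of_forall_exists_subcontinuum [SecondCountableTopology α]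
    (hK : IsCompact K) (hKc : IsConnected K) {p : α} (hp : p ∈ K)
    (h : ∀ x ∈ K, ∃ A ⊆ K, A ≠ K ∧ IsCompact A ∧ IsConnected A ∧ p ∈ A ∧ x ∈ A) :
    IsDecomposable K := by
  by_contra hdec
  let ι := {b : TopologicalSpace.countableBasis α // ((b : Set α) ∩ K).Nonempty}
  have hbopen : ∀ i : ι, IsOpen (i.1 : Set α) := fun i =>
    TopologicalSpace.isOpen_of_mem_countableBasis i.1.2
  have : Countable (TopologicalSpace.countableBasis α) :=
    (TopologicalSpace.countable_countableBasis α).to_subtype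
  let C : ι → Set α := fun i => connectedComponentIn (K \ (i.1 : Set α)) p
  have hCK : ∀ i, C i ⊆ K \ (i.1 : Set α) := fun i => connectedComponentIn_subset _ _
  have hCcl : ∀ i, IsClosed (C i) := fun i =>
    (hK.isClosed.sdiff (hbopen i)).isClosed_connectedComponentIn
  have : CompactSpace K := isCompact_iff_compactSpace.1 hK
  have : Nonempty K := ⟨⟨p, hp⟩⟩
  obtain ⟨i, x, hx⟩ := nonempty_interior_of_iUnion_of_closed
    (f := fun i : ι => ((↑) : K → α) ⁻¹' C i) (fun i => (hCcl i).preimage continuous_subtype_val)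
    (by
      refine eq_univ_of_forall fun x => mem_iUnion.2 ?_
      obtain ⟨A, hAK, hne, hAcomp, hAc, hpA, hxA⟩ := h x x.2
      obtain ⟨y, hyK, hyA⟩ : (K \ A).Nonempty :=
        nonempty_of_not_subset fun h => hne (hAK.antisymm h)
      obtain ⟨b, hb, hyb, hbA⟩ :=
        (TopologicalSpace.isBasis_countableBasis α).exists_subset_of_mem_open
          (show y ∈ Aᶜ from hyA) hAcomp.isClosed.isOpen_compl
      have hAb : A ⊆ K \ b := fun z hz => ⟨hAK hz, fun hzb => hbA hzb hz⟩
      exact ⟨⟨⟨b, hb⟩, ⟨y, hyb, hyK⟩⟩,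
        hAc.isPreconnected.subset_connectedComponentIn hpA hAb hxA⟩)
  obtain ⟨V, hVC, hV, hxV⟩ := mem_interior.1 hx
  obtain ⟨U, hU, rfl⟩ := isOpen_induced_iff.1 hV
  have hUC : U ∩ K ⊆ C i := fun z hz => @hVC ⟨z, hz.2⟩ hz.1
  have hxC : (x : α) ∈ C i := hUC ⟨hxV, x.2⟩
  have hempty := inter_eq_empty_of_not_isDecomposable hK hKc hdec
    (hK.of_isClosed_subset (hCcl i) ((hCK i).trans sdiff_subset))
    ⟨⟨_, hxC⟩, isPreconnected_connectedComponentIn⟩ ((hCK i).trans sdiff_subset)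
    (fun heq => by
      obtain ⟨y, hyb, hyK⟩ := i.2
      exact (hCK i (heq.symm ▸ hyK : y ∈ C i)).2 hyb) hU hUC
  have hxUK : (x : α) ∈ U ∩ K := ⟨hxV, x.2⟩
  rw [hempty] at hxUK
  exact hxUK

end Continua

section Dendroids

variable {α : Type*} [MetricSpace α] {K X : Set α} {f : α → ℂ}

/-- Subcontinua of a hereditarily unicoherent set contain the arcs joining their points. -/
theorem HereditarilyUnicoherent.arc_subset {A : Set α} {x y : α} (hX : HereditarilyUnicoherent X)
    (hKX : K ⊆ X) (hK : IsCompact K) (hKc : IsConnected K) (hAX : A ⊆ X)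
    (hA : IsArcWithEndpoints A x y) (hx : x ∈ K) (hy : y ∈ K) : A ⊆ K := by
  obtain ⟨γ, hγ, hinj, rfl, rfl, rfl⟩ := hA
  have h01 : (0 : ℝ) ≤ 1 := zero_le_one
  have hpre := hX K _ hKX hAX hK hKc (isCompact_Icc.image_of_continuousOn hγ)
    ((isConnected_Icc h01).image γ hγ)
  rintro _ ⟨t, ht, rfl⟩
  have h1 : Icc 0 t ⊆ Icc (0 : ℝ) 1 := Icc_subset_Icc_right ht.2
  have h2 : Icc t 1 ⊆ Icc (0 : ℝ) 1 := Icc_subset_Icc_left ht.1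
  obtain ⟨z, ⟨hzK, -⟩, ⟨r, hr, rfl⟩, ⟨s, hs, hrs⟩⟩ := isPreconnected_closed_iff.1 hpre
    (γ '' Icc 0 t) (γ '' Icc t 1)
    (isCompact_Icc.image_of_continuousOn (hγ.mono h1)).isClosed
    (isCompact_Icc.image_of_continuousOn (hγ.mono h2)).isClosed
    (by
      rw [← image_union, Icc_union_Icc_eq_Icc ht.1 ht.2]
      exact inter_subset_right)
    ⟨γ 0, ⟨hx, mem_image_of_mem _ (left_mem_Icc.2 h01)⟩, mem_image_of_mem _ (left_mem_Icc.2 ht.1)⟩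
    ⟨γ 1, ⟨hy, mem_image_of_mem _ (right_mem_Icc.2 h01)⟩,
      mem_image_of_mem _ (right_mem_Icc.2 ht.2)⟩
  have hsr : s = r := hinj (h2 hs) (h1 hr) hrs
  have : r = t := le_antisymm hr.2 (hsr ▸ hs.1)
  exact this ▸ hzK

/-- Arcs are decomposable. -/
theorem IsArc.isDecomposable {A : Set α} (hA : IsArc A) : IsDecomposable A := by
  obtain ⟨x, y, γ, hγ, hinj, rfl, -, -⟩ := hA
  have h1 : Icc 0 (1 / 2) ⊆ Icc (0 : ℝ) 1 := Icc_subset_Icc_right (by norm_num)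
  have h2 : Icc (1 / 2) 1 ⊆ Icc (0 : ℝ) 1 := Icc_subset_Icc_left (by norm_num)
  refine ⟨γ '' Icc 0 (1 / 2), γ '' Icc (1 / 2) 1, isCompact_Icc.image_of_continuousOn (hγ.mono h1),
    (isConnected_Icc (by norm_num)).image γ (hγ.mono h1),
    isCompact_Icc.image_of_continuousOn (hγ.mono h2),
    (isConnected_Icc (by norm_num)).image γ (hγ.mono h2), ?_, ?_, ?_⟩
  · intro h
    have : γ 1 ∈ γ '' Icc 0 (1 / 2) := h ▸ mem_image_of_mem _ (right_mem_Icc.2 zero_le_one)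
    obtain ⟨t, ht, hγt⟩ := this
    have := hinj (h1 ht) (right_mem_Icc.2 zero_le_one) hγt
    norm_num [this] at ht
  · intro h
    have : γ 0 ∈ γ '' Icc (1 / 2) 1 := h ▸ mem_image_of_mem _ (left_mem_Icc.2 zero_le_one)
    obtain ⟨t, ht, hγt⟩ := this
    have := hinj (h2 ht) (left_mem_Icc.2 zero_le_one) hγt
    norm_num [this] at ht
  · rw [← image_union, Icc_union_Icc_eq_Icc (by norm_num) (by norm_num)]

/-- Nondegenerate subcontinua of dendroids are decomposable. -/
theorem IsDendroid.isDecomposable [SecondCountableTopology α] (hX : IsDendroid X) (hKX : K ⊆ X)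
    (hK : IsCompact K) (hKc : IsConnected K) (hnt : K.Nontrivial) : IsDecomposable K := by
  by_contra hdec
  obtain ⟨p, hp, q, hq, hpq⟩ := hnt
  refine hdec (isDecomposable_of_forall_exists_subcontinuum hK hKc hp fun x hx => ?_)
  by_cases hpx : p = x
  · refine ⟨{p}, by simpa using hp, ?_, isCompact_singleton, isConnected_singleton, rfl, hpx.symm⟩
    intro h
    rw [← h] at hq
    exact hpq hq.symm
  · obtain ⟨A, hAX, hA⟩ := hX.2.2.2 p (hKX hp) x (hKX hx) hpx
    have hAK := hX.2.2.1.arc_subset hKX hK hKc hAX hA hp hx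
    refine ⟨A, hAK, fun h => hdec (h ▸ IsArc.isDecomposable ⟨p, x, hA⟩), ?_⟩
    obtain ⟨γ, hγ, -, rfl, rfl, rfl⟩ := hA
    exact ⟨isCompact_Icc.image_of_continuousOn hγ, (isConnected_Icc zero_le_one).image γ hγ,
      mem_image_of_mem _ (left_mem_Icc.2 zero_le_one),
      mem_image_of_mem _ (right_mem_Icc.2 zero_le_one)⟩

/-- If `f` has no continuous logarithm on each member of a chain of continua, then it has none on
their intersection. -/
theorem not_hasLogOn_sInter {c : Set (Set α)} (hchain : IsChain (· ⊆ ·) c) (hne : c.Nonempty)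
    (hc : ∀ K ∈ c, IsCompact K ∧ ContinuousOn f K ∧ ¬ HasLogOn f K) : ¬ HasLogOn f (⋂₀ c) := by
  intro hlog
  have : Nonempty c := hne.to_subtype
  obtain ⟨K₀, hK₀⟩ := hne
  have hdir : Directed (· ⊇ ·) (fun K : ↥c => (K : Set α)) :=
    fun K L => (hchain.total K.2 L.2).elim (fun h => ⟨K, Subset.rfl, h⟩)
      fun h => ⟨L, h, Subset.rfl⟩
  have hcomp : ∀ K : c, IsCompact (K : Set α) := fun K => (hc K K.2).1
  obtain ⟨H, hH⟩ := hlog.exists_continuous (isClosed_sInter fun K hK => (hc K hK).1.isClosed)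
  have hq : ContinuousOn (fun z => f z * Complex.exp (-H z)) K₀ :=
    (hc K₀ hK₀).2.1.mul (Complex.continuous_exp.comp H.continuous.neg).continuousOn
  obtain ⟨u, hu, huK⟩ := continuousOn_iff'.1 hq _ Complex.isOpen_slitPlane
  have hM : ∀ x ∈ ⋂₀ c, x ∈ u := fun x hx => by
    refine (huK.le ⟨?_, hx K₀ hK₀⟩).1
    rw [mem_preimage, ← hH x hx, ← Complex.exp_add, add_neg_cancel, Complex.exp_zero]
    exact Complex.one_mem_slitPlane
  obtain ⟨K₁, hK₁⟩ := exists_subset_nhds_of_isCompact hdir hcomp (U := u) (fun x hx => by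
    rw [← sInter_eq_iInter] at hx
    exact hu.mem_nhds (hM x hx))
  obtain ⟨K₂, h20, h21⟩ := hdir ⟨K₀, hK₀⟩ K₁
  refine (hc K₂ K₂.2).2.2 ?_
  have hslit : HasLogOn (fun z => f z * Complex.exp (-H z)) K₂ :=
    hasLogOn_of_mem_slitPlane (hq.mono h20) fun z hz => (huK.ge ⟨hK₁ (h21 hz), h20 hz⟩).1
  have hexp : HasLogOn (fun z => Complex.exp (H z)) K₂ :=
    ⟨H, H.continuous.continuousOn, fun _ _ => rfl⟩
  refine (hslit.mul hexp).congr fun z _ => ?_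
  simp only
  rw [mul_assoc, ← Complex.exp_add, neg_add_cancel, Complex.exp_zero, mul_one]

/-- Every nonvanishing continuous complex function on a dendroid has a continuous logarithm. -/
theorem IsDendroid.hasLogOn [SecondCountableTopology α] (hX : IsDendroid X)
    (hf : ContinuousOn f X) (hf0 : ∀ z ∈ X, f z ≠ 0) : HasLogOn f X := by
  by_contra hlog
  obtain ⟨K, -, ⟨hKX, hK, hKc, hKlog⟩, hmin⟩ := zorn_superset_nonempty
    {K : Set α | K ⊆ X ∧ IsCompact K ∧ IsConnected K ∧ ¬ HasLogOn f K}
    (fun c hcS hchain hne => by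
      refine ⟨⋂₀ c, ⟨?_, ?_, ?_, ?_⟩, fun s hs => sInter_subset_of_mem hs⟩
      · obtain ⟨K, hK⟩ := hne
        exact (sInter_subset_of_mem hK).trans (hcS hK).1
      · obtain ⟨K, hK⟩ := hne
        exact (hcS hK).2.1.of_isClosed_subset
          (isClosed_sInter fun L hL => (hcS hL).2.1.isClosed) (sInter_subset_of_mem hK)
      · exact hchain.isConnected_sInter hne fun K hK => ⟨(hcS hK).2.1, (hcS hK).2.2.1⟩
      · exact not_hasLogOn_sInter hchain hne fun K hK =>
          ⟨(hcS hK).2.1, hf.mono (hcS hK).1, (hcS hK).2.2.2⟩)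
    X ⟨Subset.rfl, hX.1, hX.2.1, hlog⟩
  have hproper : ∀ A ⊆ K, A ≠ K → IsCompact A → IsConnected A → HasLogOn f A := by
    intro A hAK hne hA hAc
    by_contra hAlog
    exact hne (hAK.antisymm (hmin ⟨hAK.trans hKX, hA, hAc, hAlog⟩ hAK))
  rcases K.subsingleton_or_nontrivial with hsub | hnt
  · refine hKlog ⟨fun z => Complex.log (f z), hsub.continuousOn _, fun z hz => ?_⟩
    exact Complex.exp_log (hf0 z (hKX hz))
  · obtain ⟨A, B, hA, hAc, hB, hBc, hAK, hBK, rfl⟩ := hX.isDecomposable hKX hK hKc hnt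
    exact hKlog ((hproper A subset_union_left hAK hA hAc).union
      (hproper B subset_union_right hBK hB hBc) hA.isClosed hB.isClosed
      (hX.2.2.1 A B (subset_union_left.trans hKX) (subset_union_right.trans hKX) hA hAc hB hBc))

end Dendroids

section PlaneSeparation

/-- A Möbius quotient with zero and pole in a connected open set has a continuous logarithm
off that set. -/
theorem IsPreconnected.hasLogOn_compl {W : Set ℂ} (hWc : IsPreconnected W) (hW : IsOpen W)
    {a b : ℂ} (ha : a ∈ W) (hb : b ∈ W) : HasLogOn (fun z => (z - a) / (z - b)) Wᶜ := by
  have hne : ∀ w ∈ W, ∀ z ∈ Wᶜ, z - w ≠ 0 := fun w hw z hz h =>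
    hz (by rwa [sub_eq_zero.1 h])
  refine hWc.induction₂ (fun a b => HasLogOn (fun z => (z - a) / (z - b)) Wᶜ) ?_ ?_ ?_ ha hb
  · intro x hx
    obtain ⟨r, hr, hrW⟩ := Metric.isOpen_iff.1 hW x hx
    filter_upwards [mem_nhdsWithin_of_mem_nhds (Metric.ball_mem_nhds x hr),
      self_mem_nhdsWithin] with y hy hyW
    have hlog : HasLogOn (fun z => (z - y) / (z - x)) Wᶜ := by
      refine hasLogOn_of_mem_slitPlane (ContinuousOn.div (by fun_prop) (by fun_prop) (hne x hx))
        fun z hz => ?_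
      have hzx := hne x hx z hz
      have hrz : r ≤ ‖z - x‖ := by
        rw [← dist_eq_norm]
        exact not_lt.1 fun h => hz (hrW h)
      have heq : (z - y) / (z - x) = 1 + (x - y) / (z - x) := by
        field_simp
        ring
      rw [heq]
      apply Complex.mem_slitPlane_of_norm_lt_one
      rw [norm_div, div_lt_one (hr.trans_le hrz), ← dist_eq_norm, dist_comm]
      exact (Metric.mem_ball.1 hy).trans_le hrz
    exact hlog.inv.congr fun w _ => inv_div _ _
  · intro x y z _ hy _ hxy hyz
    refine (hxy.mul hyz).congr fun w hw => ?_
    simp only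
    rw [div_mul_div_cancel₀ (hne y hy w hw)]
  · intro x y _ _ hxy
    exact hxy.inv.congr fun w _ => inv_div _ _

/-- `z ↦ z - a` has no continuous logarithm on a circle around `a`. -/
theorem not_hasLogOn_sphere (a : ℂ) {R : ℝ} (hR : 0 < R) :
    ¬ HasLogOn (fun z => z - a) (Metric.sphere a R) := by
  rintro ⟨h, hc, he⟩
  have hmem : ∀ t : ℝ, circleMap a R t ∈ Metric.sphere a R := fun t =>
    circleMap_mem_sphere a hR.le t
  have hconst := isPreconnected_univ.sub_eq_sub_of_exp_eq
    (h := fun t : ℝ => h (circleMap a R t)) (k := fun t : ℝ => (Real.log R : ℂ) + t * Complex.I)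
    (hc.comp (continuous_circleMap a R).continuousOn fun t _ => hmem t)
    (by fun_prop) (fun t _ => by
      rw [he _ (hmem t), Complex.exp_add, ← Complex.ofReal_exp, Real.exp_log hR]
      simp [circleMap]) (mem_univ 0) (mem_univ (2 * Real.pi))
  have hper : circleMap a R (2 * Real.pi) = circleMap a R 0 := by
    simpa using periodic_circleMap a R 0
  simp only [hper, sub_right_inj, add_right_inj, Complex.ofReal_zero, zero_mul] at hconst
  have := Complex.two_pi_I_ne_zero
  push_cast at hconst
  exact this hconst.symm

/-- A nonvanishing continuous function on the plane has a continuous logarithm. -/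
theorem hasLogOn_univ {F : ℂ → ℂ} (hF : Continuous F) (hF0 : ∀ z, F z ≠ 0) :
    HasLogOn F univ := by
  obtain ⟨G, ⟨-, hG⟩, -⟩ := Complex.isCoveringMapOn_exp.existsUnique_continuousMap_lifts
    ⟨F, hF⟩ (a₀ := 0) (e₀ := Complex.log (F 0)) (Complex.exp_log (hF0 0)) fun z => hF0 z
  exact ⟨G, G.continuous.continuousOn, fun z _ => congrFun hG z⟩

/-- If `(z - a) / (z - b)` has a continuous logarithm on a closed set, then that set does not
separate `a`, assumed to lie in a bounded complementary component, from `b`. -/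
theorem mem_connectedComponentIn_of_hasLogOn {S : Set ℂ} (hS : IsClosed S) {a b : ℂ} (ha : a ∉ S)
    (hb : b ∉ S) (hlog : HasLogOn (fun z => (z - a) / (z - b)) S)
    (hbd : Bornology.IsBounded (connectedComponentIn Sᶜ a)) : b ∈ connectedComponentIn Sᶜ a := by
  classical
  by_contra hbU
  set U := connectedComponentIn Sᶜ a with hU
  have haU : a ∈ U := mem_connectedComponentIn ha
  have hUo : IsOpen U := hS.isOpen_compl.connectedComponentIn
  have hfr : ∀ z ∈ frontier U, z ∈ S := by
    intro z hz
    by_contra hzS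
    have hV : connectedComponentIn Sᶜ z ∈ 𝓝 z :=
      connectedComponentIn_mem_nhds (hS.isOpen_compl.mem_nhds hzS)
    obtain ⟨y, hyV, hyU⟩ := mem_closure_iff_nhds.1 (frontier_subset_closure hz) _ hV
    have hzU : z ∈ U := by
      rw [hU, connectedComponentIn_eq hyU, ← connectedComponentIn_eq hyV]
      exact mem_connectedComponentIn hzS
    rw [hUo.frontier_eq] at hz
    exact hz.2 hzU
  obtain ⟨H, hH⟩ := hlog.exists_continuous hS
  let F : ℂ → ℂ := U.piecewise (fun z => (z - b) * Complex.exp (H z)) fun z => z - a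
  have hF : Continuous F := by
    refine continuous_piecewise ?_ (by fun_prop) (by fun_prop)
    intro z hz
    have hzS := hfr z hz
    rw [hH z hzS, mul_div_cancel₀]
    exact fun h => hb (by rwa [← sub_eq_zero.1 h])
  have hF0 : ∀ z, F z ≠ 0 := by
    intro z
    by_cases hz : z ∈ U
    · simp only [F, piecewise_eq_of_mem _ _ _ hz]
      exact mul_ne_zero (fun h => hbU (by rwa [← sub_eq_zero.1 h])) (Complex.exp_ne_zero _)
    · simp only [F, piecewise_eq_of_notMem _ _ _ hz]
      exact fun h => hz (by rwa [sub_eq_zero.1 h])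
  obtain ⟨R, hR, hUR⟩ := hbd.subset_ball_lt 0 a
  refine not_hasLogOn_sphere a hR (((hasLogOn_univ hF hF0).mono (subset_univ _)).congr
    fun z hz => ?_)
  refine piecewise_eq_of_notMem _ _ _ fun hzU => ?_
  have := hUR hzU
  rw [Metric.mem_ball] at this
  exact this.ne hz

/-- A form of Janiszewski's theorem: if a closed set `X` carries logarithms of all quotients
`(z - a) / (z - b)` and meets the complement of the bounded domain `W` in a connected set, then
`W \ X` is connected. -/
theorem isPreconnected_diff_of_hasLogOn {W X : Set ℂ} (hWc : IsPreconnected W) (hW : IsOpen W)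
    (hWbd : Bornology.IsBounded W) (hX : IsClosed X)
    (hlog : ∀ a ∉ X, ∀ b ∉ X, HasLogOn (fun z => (z - a) / (z - b)) X)
    (hXW : IsPreconnected (X \ W)) : IsPreconnected (W \ X) := by
  have hcompl : (X ∪ Wᶜ)ᶜ = W \ X := by
    rw [compl_union, compl_compl, inter_comm, sdiff_eq]
  refine isPreconnected_of_forall_pair fun a ha b hb => ?_
  have hsub : connectedComponentIn (X ∪ Wᶜ)ᶜ a ⊆ W \ X :=
    hcompl ▸ connectedComponentIn_subset _ _
  have ha' : a ∈ (X ∪ Wᶜ)ᶜ := hcompl ▸ ha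
  have hb' : b ∈ (X ∪ Wᶜ)ᶜ := hcompl ▸ hb
  exact ⟨_, hsub, mem_connectedComponentIn ha',
    mem_connectedComponentIn_of_hasLogOn (hX.union hW.isClosed_compl) ha' hb'
      ((hlog a ha.2 b hb.2).union (hWc.hasLogOn_compl hW ha.1 hb.1) hX hW.isClosed_compl hXW)
      (hWbd.subset (hsub.trans sdiff_subset)), isPreconnected_connectedComponentIn⟩

end PlaneSeparation

/-- Lemma 5. -/
theorem stmt_2 (X : Set Plane) (hX : IsDendroid X)
    (W : Set Plane) (hWopen : IsOpen W) (hWbd : Bornology.IsBounded W)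
    (hWconn : IsConnected W) (hWsc : SimplyConnectedSpace ↥W)
    (hXW : IsPreconnected (X \ W)) :
    IsPreconnected (W \ X) := by
  let e : Plane ≃ₜ ℂ := Complex.orthonormalBasisOneI.repr.symm.toHomeomorph
  have himg : e '' (W \ X) = e '' W \ e '' X := image_sdiff e.injective _ _
  have hlip : LipschitzWith 1 e := Complex.orthonormalBasisOneI.repr.symm.lipschitz
  have hmain : IsPreconnected (e '' W \ e '' X) := by
    refine isPreconnected_diff_of_hasLogOn
      (hWconn.isPreconnected.image e e.continuous.continuousOn)
      (e.isOpenMap W hWopen) (hlip.isBounded_image hWbd) (e.isClosedMap X hX.1.isClosed) ?_ ?_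
    · intro a ha b hb
      have hne : ∀ c, c ∉ e '' X → ∀ z ∈ X, e z - c ≠ 0 := fun c hc z hz h =>
        hc ⟨z, hz, sub_eq_zero.1 h⟩
      obtain ⟨h, hc, he⟩ := hX.hasLogOn (f := fun z => (e z - a) / (e z - b))
        (ContinuousOn.div (e.continuous.sub continuous_const).continuousOn
          (e.continuous.sub continuous_const).continuousOn (hne b hb))
        fun z hz => div_ne_zero (hne a ha z hz) (hne b hb z hz)
      refine ⟨h ∘ e.symm, hc.comp e.symm.continuous.continuousOn ?_, ?_⟩
      · rintro _ ⟨z, hz, rfl⟩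
        simpa using hz
      · rintro _ ⟨z, hz, rfl⟩
        simpa using he z hz
    · rw [← image_sdiff e.injective]
      exact hXW.image e e.continuous.continuousOn
  rw [← himg] at hmain
  exact e.isPreconnected_image.1 hmain
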